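/- Suppose the experiment choice function X* has full dimension and let t : Δ(Ω) → ℝ. For each k let u_{k,t}(p) = t(p) − θ_k·c(p) and let s_{k,t} be the unique affine function on Δ(Ω) agreeing with u_{k,t} at every point of S_k. Then the results-based contract (X*, t) is incentive-compatible if and only if the secant hyperplane condition holds: s_{k,t}(p) ≥ u_{k,t}(p) for every p ∈ Δ(Ω) and every k ∈ {1, …, N}. -/

import Mathlib

open Finset

/-- A finitely supported, Bayes-plausible distribution over posterior beliefs:
the formal notion of an *experiment*. -/
structure Experiment (Ω : Type*) [Fintype Ω] (p₀ : Ω → ℝ) where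
  w : (Ω → ℝ) →₀ ℝ
  nonneg : ∀ p, 0 ≤ w p
  mem_simplex : ∀ p ∈ w.support, p ∈ stdSimplex ℝ Ω
  total : (w.sum fun _ a => a) = 1
  bayes : (w.sum fun p a => a • p) = p₀

namespace Experiment

variable {Ω : Type*} [Fintype Ω] {p₀ : Ω → ℝ}

/-- Expectation `E_{p ∼ τ}[φ(p)]` of a function of the posterior. -/
noncomputable def exp (τ : Experiment Ω p₀) (φ : (Ω → ℝ) → ℝ) : ℝ :=
  τ.w.sum fun p a => a * φ p

/-- The (finite) support of an experiment. -/
def supp (τ : Experiment Ω p₀) : Finset (Ω → ℝ) := τ.w.support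

end Experiment

/-- The support of the experiment is an affinely independent subset of Δ(Ω). -/
def AffIndepSupp {Ω : Type*} [Fintype Ω] {p₀ : Ω → ℝ} (τ : Experiment Ω p₀) : Prop :=
  AffineIndependent ℝ (fun p : (τ.supp : Set (Ω → ℝ)) => (p : Ω → ℝ))

/-- Full dimension: affinely independent supports of size `|Ω|` (types are `0, …, N-1`). -/
def FullDimension {Ω : Type*} [Fintype Ω] {p₀ : Ω → ℝ} (N : ℕ)
    (𝒳 : ℕ → Experiment Ω p₀) : Prop :=
  ∀ k < N, AffIndepSupp (𝒳 k) ∧ (𝒳 k).supp.card = Fintype.card Ω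

/-- Affine maps commute with finitely supported combinations of total weight one. -/
theorem AffineMap.linearCombination_eq {V : Type*} [AddCommGroup V] [Module ℝ V]
    (f : V →ᵃ[ℝ] ℝ) (m : V →₀ ℝ)
    (hm : Finsupp.linearCombination ℝ (fun _ : V => (1 : ℝ)) m = 1) :
    Finsupp.linearCombination ℝ f m = f (Finsupp.linearCombination ℝ (fun p : V => p) m) := by
  obtain ⟨b, hf⟩ : ∃ b, ∀ p, f p = f.linear p + b := ⟨f 0, congrFun f.decomp⟩
  simp only [Finsupp.linearCombination_apply, Finsupp.sum, smul_eq_mul, mul_one] at hm ⊢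
  rw [hf (∑ p ∈ m.support, m p • p), map_sum]
  simp only [hf, mul_add, Finset.sum_add_distrib, ← Finset.sum_mul, hm, map_smul, smul_eq_mul,
    one_mul]

/-- Affinely independent points of the simplex are linearly independent. -/
theorem AffineIndependent.linearIndependent_of_mem_stdSimplex {Ω ι : Type*} [Fintype Ω]
    {v : ι → Ω → ℝ} (hv : AffineIndependent ℝ v) (hmem : ∀ i, v i ∈ stdSimplex ℝ Ω) :
    LinearIndependent ℝ v := by
  rw [linearIndependent_iff']
  intro s g hg
  refine (affineIndependent_iff.1 hv) s g ?_ hg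
  have h := congrArg (fun x : Ω → ℝ => ∑ ω, x ω) hg
  simp only [Finset.sum_apply, Pi.smul_apply, smul_eq_mul, Pi.zero_apply,
    Finset.sum_const_zero] at h
  rw [Finset.sum_comm] at h
  simpa only [← Finset.mul_sum, (hmem _).2, mul_one] using h

namespace Experiment

variable {Ω : Type*} [Fintype Ω] {p₀ : Ω → ℝ}

theorem exp_eq_linearCombination (τ : Experiment Ω p₀) (φ : (Ω → ℝ) → ℝ) :
    τ.exp φ = Finsupp.linearCombination ℝ φ τ.w := rfl

theorem linearCombination_one (τ : Experiment Ω p₀) :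
    Finsupp.linearCombination ℝ (fun _ : Ω → ℝ => (1 : ℝ)) τ.w = 1 := by
  simpa [Finsupp.linearCombination_apply] using τ.total

theorem linearCombination_id (τ : Experiment Ω p₀) :
    Finsupp.linearCombination ℝ (fun p : Ω → ℝ => p) τ.w = p₀ := τ.bayes

theorem exp_affineMap (τ : Experiment Ω p₀) (f : (Ω → ℝ) →ᵃ[ℝ] ℝ) : τ.exp f = f p₀ := by
  rw [exp_eq_linearCombination, f.linearCombination_eq _ τ.linearCombination_one,
    τ.linearCombination_id]

theorem exp_sub_mul (τ : Experiment Ω p₀) (φ ψ : (Ω → ℝ) → ℝ) (a : ℝ) :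
    τ.exp (fun p => φ p - a * ψ p) = τ.exp φ - a * τ.exp ψ := by
  simp only [exp, Finsupp.sum, Finset.mul_sum, ← Finset.sum_sub_distrib]
  exact Finset.sum_congr rfl fun _ _ => by ring

theorem exp_mono (τ : Experiment Ω p₀) {φ ψ : (Ω → ℝ) → ℝ} (h : ∀ p ∈ τ.supp, φ p ≤ ψ p) :
    τ.exp φ ≤ τ.exp ψ :=
  Finset.sum_le_sum fun p hp => mul_le_mul_of_nonneg_left (h p hp) (τ.nonneg p)

theorem exp_congr (τ : Experiment Ω p₀) {φ ψ : (Ω → ℝ) → ℝ} (h : ∀ p ∈ τ.supp, φ p = ψ p) :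
    τ.exp φ = τ.exp ψ :=
  Finset.sum_congr rfl fun p hp => congrArg (τ.w p * ·) (h p hp)

/-- If the support is affinely independent of full size, every belief is a signed combination,
of total weight one, of support points. -/
theorem exists_signed_combination (τ : Experiment Ω p₀) (hind : AffIndepSupp τ)
    (hcard : τ.supp.card = Fintype.card Ω) {q : Ω → ℝ} (hq : q ∈ stdSimplex ℝ Ω) :
    ∃ l : (Ω → ℝ) →₀ ℝ, l.support ⊆ τ.supp ∧
      Finsupp.linearCombination ℝ (fun _ : Ω → ℝ => (1 : ℝ)) l = 1 ∧
      Finsupp.linearCombination ℝ (fun p : Ω → ℝ => p) l = q := by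
  have hli : LinearIndependent ℝ (fun p : (τ.supp : Set (Ω → ℝ)) => (p : Ω → ℝ)) :=
    AffineIndependent.linearIndependent_of_mem_stdSimplex hind fun p => τ.mem_simplex p p.2
  have hspan : Submodule.span ℝ (τ.supp : Set (Ω → ℝ)) = ⊤ := by
    have h := hli.span_eq_top_of_card_eq_finrank' (by simp [hcard])
    simpa using h
  have hmem : q ∈ Submodule.span ℝ ((fun p : Ω → ℝ => p) '' (τ.supp : Set (Ω → ℝ))) := by
    simp [hspan]
  obtain ⟨l, hl, hlq⟩ := (Finsupp.mem_span_image_iff_linearCombination ℝ).1 hmem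
  have hsub : l.support ⊆ τ.supp := by
    exact_mod_cast (Finsupp.mem_supported ℝ l).1 hl
  refine ⟨l, hsub, ?_, hlq⟩
  have h := congrArg (fun x : Ω → ℝ => ∑ ω, x ω) hlq
  simp only [Finsupp.linearCombination_apply, Finsupp.sum, Finset.sum_apply, Pi.smul_apply,
    smul_eq_mul, hq.2] at h
  rw [Finset.sum_comm] at h
  rw [Finsupp.linearCombination_apply, Finsupp.sum]
  refine Eq.trans ?_ h
  refine Finset.sum_congr rfl fun p hp => ?_
  rw [← Finset.mul_sum, (τ.mem_simplex p (hsub hp)).2, smul_eq_mul]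

/-- A small amount of mass can be moved from the support of an experiment to any belief that is
a signed combination of support points, along that combination. -/
theorem exists_perturbation (τ : Experiment Ω p₀) {q : Ω → ℝ} (hq : q ∈ stdSimplex ℝ Ω)
    {l : (Ω → ℝ) →₀ ℝ} (hsub : l.support ⊆ τ.supp)
    (hone : Finsupp.linearCombination ℝ (fun _ : Ω → ℝ => (1 : ℝ)) l = 1)
    (hid : Finsupp.linearCombination ℝ (fun p : Ω → ℝ => p) l = q) :
    ∃ ε > (0 : ℝ), ∃ σ : Experiment Ω p₀, σ.w = τ.w + ε • (Finsupp.single q 1 - l) := by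
  have hev : ∀ᶠ ε : ℝ in nhdsWithin 0 (Set.Ioi 0), ∀ p ∈ τ.supp, ε * l p < τ.w p := by
    rw [Filter.eventually_all_finset]
    intro p hp
    have hw : 0 < τ.w p := lt_of_le_of_ne (τ.nonneg p) (Finsupp.mem_support_iff.1 hp).symm
    have hc : Continuous fun ε : ℝ => ε * l p := by fun_prop
    refine Filter.Eventually.filter_mono nhdsWithin_le_nhds ?_
    exact hc.continuousAt.eventually_lt_const (by simpa using hw)
  obtain ⟨ε, hε, hpos : 0 < ε⟩ := (hev.and self_mem_nhdsWithin).exists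
  have hle : ∀ p, ε * l p ≤ τ.w p := by
    intro p
    by_cases hp : p ∈ τ.supp
    · exact (hε p hp).le
    · rw [Finsupp.notMem_support_iff.1 fun h => hp (hsub h), mul_zero]
      exact τ.nonneg p
  refine ⟨ε, hpos, ⟨τ.w + ε • (Finsupp.single q 1 - l), ?_, ?_, ?_, ?_⟩, rfl⟩
  · intro p
    have hs : 0 ≤ Finsupp.single q (1 : ℝ) p := by
      classical
      rw [Finsupp.single_apply]
      split_ifs <;> norm_num
    simp only [Finsupp.add_apply, Finsupp.smul_apply, Finsupp.sub_apply, smul_eq_mul, mul_sub]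
    linarith [hle p, mul_nonneg hpos.le hs]
  · intro p hp
    by_cases hpq : p = q
    · exact hpq ▸ hq
    · by_contra hns
      have hτ : p ∉ τ.w.support := fun h => hns (τ.mem_simplex p h)
      have hl : p ∉ l.support := fun h => hτ (hsub h)
      rw [Finsupp.notMem_support_iff] at hτ hl
      rw [Finsupp.mem_support_iff] at hp
      apply hp
      simp [hτ, hl, hpq]
  · have h : Finsupp.linearCombination ℝ (fun _ : Ω → ℝ => (1 : ℝ))
        (τ.w + ε • (Finsupp.single q 1 - l)) = 1 := by
      simp only [map_add, map_smul, map_sub, hone, τ.linearCombination_one,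
        Finsupp.linearCombination_single]
      simp
    simpa only [Finsupp.linearCombination_apply, smul_eq_mul, mul_one] using h
  · change Finsupp.linearCombination ℝ (fun p : Ω → ℝ => p)
        (τ.w + ε • (Finsupp.single q 1 - l)) = p₀
    simp only [map_add, map_smul, map_sub, hid, τ.linearCombination_id,
      Finsupp.linearCombination_single]
    simp

end Experiment

/-- Lemma 4: for fully dimensional `𝒳`, a results-based contract is
incentive-compatible iff the secant hyperplane condition holds. -/
theorem secant_hyperplane_characterization
    {Ω : Type*} [Fintype Ω] [Nonempty Ω]
    (p₀ : Ω → ℝ) (hp₀ : p₀ ∈ stdSimplex ℝ Ω) (hp₀_pos : ∀ ω, 0 < p₀ ω)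
    (c : (Ω → ℝ) → ℝ)
    (hc_cont : ContinuousOn c (stdSimplex ℝ Ω))
    (hc_sconv : StrictConvexOn ℝ (stdSimplex ℝ Ω) c)
    (hc_nonneg : ∀ p ∈ stdSimplex ℝ Ω, 0 ≤ c p)
    (hc_zero : c p₀ = 0)
    (N : ℕ) (hN : 0 < N) (θ : ℕ → ℝ)
    (hθ_pos : ∀ k < N, 0 < θ k)
    (hθ_anti : ∀ i j, i < j → j < N → θ j < θ i)
    (𝒳 : ℕ → Experiment Ω p₀)
    (hfd : FullDimension N 𝒳)
    (t : (Ω → ℝ) → ℝ)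
    (s : ℕ → (Ω → ℝ) →ᵃ[ℝ] ℝ)
    (hs : ∀ k < N, ∀ p ∈ (𝒳 k).supp, s k p = t p - θ k * c p) :
    (∀ k < N, ∀ τ : Experiment Ω p₀,
      τ.exp t - θ k * τ.exp c ≤ (𝒳 k).exp t - θ k * (𝒳 k).exp c) ↔
    (∀ k < N, ∀ p ∈ stdSimplex ℝ Ω, t p - θ k * c p ≤ s k p) := by
  simp only [← Experiment.exp_sub_mul]
  constructor
  · intro hIC k hk q hq
    obtain ⟨l, hsub, hone, hid⟩ :=
      (𝒳 k).exists_signed_combination (hfd k hk).1 (hfd k hk).2 hq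
    obtain ⟨ε, hε, σ, hσ⟩ := (𝒳 k).exists_perturbation hq hsub hone hid
    have h := hIC k hk σ
    have hl : Finsupp.linearCombination ℝ (fun p => t p - θ k * c p) l = s k q := by
      rw [← hid, ← (s k).linearCombination_eq l hone]
      exact Finset.sum_congr rfl fun p hp => by simp [hs k hk p (hsub hp)]
    rw [Experiment.exp_eq_linearCombination, Experiment.exp_eq_linearCombination, hσ, map_add,
      map_smul, map_sub, hl, Finsupp.linearCombination_single, one_smul, smul_eq_mul] at h
    by_contra! hlt
    nlinarith [mul_pos hε (sub_pos.2 hlt)]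
  · intro hS k hk τ
    calc τ.exp (fun p => t p - θ k * c p) ≤ τ.exp (s k) :=
          τ.exp_mono fun p hp => hS k hk p (τ.mem_simplex p hp)
      _ = (𝒳 k).exp (s k) := by rw [τ.exp_affineMap, (𝒳 k).exp_affineMap]
      _ = (𝒳 k).exp (fun p => t p - θ k * c p) := (𝒳 k).exp_congr (hs k hk)
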